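/- Let H̃ ∈ Ω_{2n} be an invertible Hermitian complex matrix and let Ã ∈ Ω_{2n} be H̃-selfadjoint. Then there exists an invertible matrix S ∈ Ω_{2n}, an integer β with 0 ≤ α ≤ β, sizes k_1,…,k_β, real numbers λ_1,…,λ_α, complex numbers λ_{α+1},…,λ_β with strictly positive imaginary part, and signs η_1,…,η_α ∈ {1,−1}, such that S⁻¹ÃS = [J_{k_1}(λ_1) ⊕ ⋯ ⊕ J_{k_α}(λ_α) ⊕ (J_{k_{α+1}}(λ_{α+1}) ⊕ J_{k_{α+1}}(conj λ_{α+1})) ⊕ ⋯ ⊕ (J_{k_β}(λ_β) ⊕ J_{k_β}(conj λ_β))] ⊕ [J_{k_1}(λ_1) ⊕ ⋯ ⊕ J_{k_α}(λ_α) ⊕ (J_{k_{α+1}}(conj λ_{α+1}) ⊕ J_{k_{α+1}}(λ_{α+1})) ⊕ ⋯ ⊕ (J_{k_β}(conj λ_β) ⊕ J_{k_β}(λ_β))] and S*H̃S = [η_1 Q_{k_1} ⊕ ⋯ ⊕ η_α Q_{k_α} ⊕ Q_{2k_{α+1}} ⊕ ⋯ ⊕ Q_{2k_β}] ⊕ [η_1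 Q_{k_1} ⊕ ⋯ ⊕ η_α Q_{k_α} ⊕ Q_{2k_{α+1}} ⊕ ⋯ ⊕ Q_{2k_β}]. -/

import Mathlib

open Matrix

noncomputable section

/-- The `k×k` upper-triangular Jordan block with eigenvalue `lam`. -/
def jordanBlock {R : Type*} [Zero R] [One R] (lam : R) (k : ℕ) : Matrix (Fin k) (Fin k) R :=
  Matrix.of fun i j => if (i : ℕ) = (j : ℕ) then lam else if (i : ℕ) + 1 = (j : ℕ) then 1 else 0

/-- The `k×k` sip matrix: ones on the main anti-diagonal, zeros elsewhere. -/
def sip (R : Type*) [Zero R] [One R] (k : ℕ) : Matrix (Fin k) (Fin k) R :=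
  Matrix.of fun i j => if (i : ℕ) + (j : ℕ) = k - 1 then 1 else 0

/-- The order-preserving identification of `Fin k ⊕ Fin k` with `Fin (2*k)`. -/
def finTwoMul (k : ℕ) : (Fin k ⊕ Fin k) ≃ Fin (2 * k) :=
  finSumFinEquiv.trans (finCongr (two_mul k).symm)

/-- Block-diagonal direct sum `M ⊕ N` of two `k×k` matrices, as a `(2k)×(2k)` matrix. -/
def dsum2 {R : Type*} [Zero R] {k : ℕ} (M N : Matrix (Fin k) (Fin k) R) :
    Matrix (Fin (2 * k)) (Fin (2 * k)) R :=
  Matrix.reindex (finTwoMul k) (finTwoMul k) (Matrix.fromBlocks M 0 0 N)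

/-- The `2n×2n` complex matrix `[[A₁, conj A₂], [−A₂, conj A₁]]`. -/
def omegaMap {n : ℕ} (A₁ A₂ : Matrix (Fin n) (Fin n) ℂ) :
    Matrix (Fin (2 * n)) (Fin (2 * n)) ℂ :=
  Matrix.reindex (finTwoMul n) (finTwoMul n)
    (Matrix.fromBlocks A₁ (A₂.map (starRingEnd ℂ)) (-A₂) (A₁.map (starRingEnd ℂ)))

/-- Membership in the real subalgebra `Ω_{2n}` of `2n×2n` complex matrices. -/
def InOmega {n : ℕ} (M : Matrix (Fin (2 * n)) (Fin (2 * n)) ℂ) : Prop :=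
  ∃ A₁ A₂ : Matrix (Fin n) (Fin n) ℂ, M = omegaMap A₁ A₂

/-- A complex model of a quaternionic vector space: a complex space with a conjugate-linear map
`σ` of square `-1`, a nondegenerate Hermitian form `h` compatible with `σ`, and an operator `A`
that commutes with `σ` and is selfadjoint for `h`. -/
structure QuatSpace (V : Type) [AddCommGroup V] [Module ℂ V] where
  A : Module.End ℂ V
  σ : V →ₛₗ[starRingEnd ℂ] V
  h : V → V →ₗ[ℂ] ℂ
  σ_σ : ∀ x, σ (σ x) = -x
  A_σ : ∀ x, A (σ x) = σ (A x)
  h_symm : ∀ x y, starRingEnd ℂ (h x y) = h y x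
  h_σ : ∀ x y, h (σ x) (σ y) = starRingEnd ℂ (h x y)
  h_A : ∀ x y, h (A x) y = h x (A y)
  nondeg : ∀ x, (∀ y, h y x = 0) → x = 0

namespace QuatSpace

variable {V : Type} [AddCommGroup V] [Module ℂ V] (D : QuatSpace V)

lemma h_add_left (x y z : V) : D.h (x + y) z = D.h x z + D.h y z := by
  rw [← D.h_symm, map_add, map_add, D.h_symm, D.h_symm]

lemma h_neg_left (x z : V) : D.h (-x) z = -D.h x z := by
  rw [← D.h_symm, map_neg, map_neg, D.h_symm]

lemma h_smul_left (c : ℂ) (x z : V) : D.h (c • x) z = starRingEnd ℂ c * D.h x z := by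
  rw [← D.h_symm, map_smul, smul_eq_mul, map_mul, D.h_symm]

lemma h_zero_left (z : V) : D.h 0 z = 0 := by
  rw [← D.h_symm, map_zero, map_zero]

lemma h_sum_left {ι : Type*} (s : Finset ι) (f : ι → V) (z : V) :
    D.h (∑ i ∈ s, f i) z = ∑ i ∈ s, D.h (f i) z := by
  rw [← D.h_symm, map_sum, map_sum]
  simp only [D.h_symm]

lemma h_zero_comm {x y : V} (hxy : D.h x y = 0) : D.h y x = 0 := by
  rw [← D.h_symm, hxy, map_zero]

lemma h_σ_right (x y : V) : D.h x (D.σ y) = -D.h y (D.σ x) := by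
  have h1 := D.h_σ (D.σ x) y
  rw [D.σ_σ, D.h_neg_left, D.h_symm] at h1
  rw [← h1, neg_neg]

/-- The shifted operator `A - lam`. -/
def shift (lam : ℂ) : Module.End ℂ V := D.A - lam • 1

lemma shift_apply (lam : ℂ) (x : V) : D.shift lam x = D.A x - lam • x := rfl

lemma h_shift (lam : ℂ) (x y : V) :
    D.h (D.shift lam x) y = D.h x (D.shift (starRingEnd ℂ lam) y) := by
  simp [shift_apply, sub_eq_add_neg, D.h_add_left, D.h_neg_left, D.h_smul_left, D.h_A]

lemma h_shift_pow (lam : ℂ) (k : ℕ) (x y : V) :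
    D.h ((D.shift lam ^ k) x) y = D.h x ((D.shift (starRingEnd ℂ lam) ^ k) y) := by
  induction k generalizing x y with
  | zero => simp
  | succ k ih =>
    rw [pow_succ, Module.End.mul_apply, ih, h_shift, pow_succ', Module.End.mul_apply]

lemma shift_σ (lam : ℂ) (x : V) :
    D.shift lam (D.σ x) = D.σ (D.shift (starRingEnd ℂ lam) x) := by
  simp [shift_apply, D.A_σ]

lemma shift_pow_σ (lam : ℂ) (k : ℕ) (x : V) :
    (D.shift lam ^ k) (D.σ x) = D.σ ((D.shift (starRingEnd ℂ lam) ^ k) x) := by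
  induction k with
  | zero => simp
  | succ k ih =>
    rw [pow_succ', Module.End.mul_apply, ih, shift_σ, pow_succ', Module.End.mul_apply]

/-- Root vectors for `lam` and `μ` are orthogonal unless `μ = conj lam`. -/
lemma h_eq_zero_of_pow {lam μ : ℂ} (hne : starRingEnd ℂ lam ≠ μ) :
    ∀ (s p q : ℕ), p + q = s → ∀ x y : V, (D.shift lam ^ p) x = 0 → (D.shift μ ^ q) y = 0 →
      D.h x y = 0 := by
  intro s
  induction s with
  | zero =>
    intro p q hpq x y hx _
    obtain rfl : p = 0 := by omega
    have : x = 0 := by simpa using hx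
    rw [this, D.h_zero_left]
  | succ s ih =>
    intro p q hpq x y hx hy
    rcases p with _ | p
    · have : x = 0 := by simpa using hx
      rw [this, D.h_zero_left]
    rcases q with _ | q
    · have : y = 0 := by simpa using hy
      rw [this, map_zero]
    have h1 := ih p (q + 1) (by omega) (D.shift lam x) y
      (by rwa [pow_succ, Module.End.mul_apply] at hx) hy
    have h2 := ih (p + 1) q (by omega) x (D.shift μ y) hx
      (by rwa [pow_succ, Module.End.mul_apply] at hy)
    rw [h_shift] at h1
    simp only [shift_apply, map_sub, map_smul, smul_eq_mul] at h1 h2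
    have h3 : (starRingEnd ℂ lam - μ) * D.h x y = 0 := by linear_combination h2 - h1
    exact (mul_eq_zero.mp h3).resolve_left (sub_ne_zero.mpr hne)

/-- A root vector of maximal height pairs nontrivially with a root vector for the conjugate
eigenvalue. -/
lemma exists_top [FiniteDimensional ℂ V] {lam : ℂ} (hlam : ∃ x : V, x ≠ 0 ∧ D.A x = lam • x) :
    ∃ (K : ℕ) (u y : V), (D.shift lam ^ (K + 1)) u = 0 ∧ (D.shift lam ^ (K + 1)) y = 0 ∧
      D.h (D.σ y) ((D.shift lam ^ K) u) ≠ 0 := by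
  classical
  obtain ⟨d, hd, hd1⟩ :=
    ((D.shift (starRingEnd ℂ lam)).eventually_isCompl_ker_pow_range_pow.and
      (Filter.eventually_ge_atTop 1)).exists
  have hex : ∃ m, ∀ x, (D.shift lam ^ d) x = 0 → (D.shift lam ^ m) x = 0 := ⟨d, fun _ hx => hx⟩
  have hspec := Nat.find_spec hex
  have hmin := fun m => Nat.find_min (m := m) hex
  have hle : Nat.find hex ≤ d := Nat.find_min' hex fun _ hx => hx
  generalize Nat.find hex = k at hspec hmin hle
  obtain ⟨x, hx0, hx⟩ := hlam
  have hNx : D.shift lam x = 0 := by rw [shift_apply, hx, sub_self]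
  rcases k with _ | K
  · obtain ⟨d, rfl⟩ := Nat.exists_eq_add_of_le' hd1
    exact absurd (by simpa using hspec x (by rw [pow_succ, Module.End.mul_apply, hNx, map_zero]))
      hx0
  · have := hmin K (by omega)
    push Not at this
    obtain ⟨u, hu, huK⟩ := this
    have : ∃ z, D.h z ((D.shift lam ^ K) u) ≠ 0 := by
      by_contra! hc
      exact huK (D.nondeg _ hc)
    obtain ⟨z, hz⟩ := this
    obtain ⟨z0, hz0, z1, hz1, rfl⟩ := Submodule.mem_sup.mp
      (show z ∈ _ from hd.sup_eq_top ▸ Submodule.mem_top)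
    obtain ⟨w, rfl⟩ := hz1
    have hz1' : D.h ((D.shift (starRingEnd ℂ lam) ^ d) w) ((D.shift lam ^ K) u) = 0 := by
      rw [h_shift_pow, Complex.conj_conj, ← Module.End.mul_apply, ← pow_add, add_comm, pow_add,
        Module.End.mul_apply, hu, map_zero, map_zero]
    rw [D.h_add_left, hz1', add_zero] at hz
    refine ⟨K, u, -D.σ z0, hspec u hu, hspec _ ?_, ?_⟩
    · rw [map_neg, shift_pow_σ, LinearMap.mem_ker.mp hz0, map_zero, neg_zero]
    · rwa [map_neg, D.σ_σ, neg_neg]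

/-- Normalisation of a chain against a linear functional. -/
lemma exists_linear_normal (N : Module.End ℂ V) (φ : V →ₗ[ℂ] ℂ) (K : ℕ) (u : V)
    (hu : (N ^ (K + 1)) u = 0) (hφ : φ ((N ^ K) u) = 1) (m : ℕ) :
    ∃ u', (N ^ (K + 1)) u' = 0 ∧ φ ((N ^ K) u') = 1 ∧
      ∀ i, i < K → K ≤ i + m → φ ((N ^ i) u') = 0 := by
  induction m with
  | zero => exact ⟨u, hu, hφ, fun i h1 h2 => by omega⟩
  | succ m ih =>
    obtain ⟨u', h1, h2, h3⟩ := ih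
    by_cases hm : K < m + 1
    · exact ⟨u', h1, h2, fun i hi _ => h3 i hi (by omega)⟩
    have hz : ∀ j, K + 1 ≤ j → (N ^ j) u' = 0 := fun j hj => by
      obtain ⟨c, rfl⟩ := Nat.exists_eq_add_of_le' hj
      rw [pow_add, Module.End.mul_apply, h1, map_zero]
    have key : ∀ i (t : ℂ), (N ^ i) (u' + t • (N ^ (m + 1)) u') =
        (N ^ i) u' + t • (N ^ (i + (m + 1))) u' := fun i t => by
      rw [map_add, map_smul, pow_add N i, Module.End.mul_apply]
    refine ⟨u' + (-φ ((N ^ (K - (m + 1))) u')) • (N ^ (m + 1)) u', ?_, ?_, fun i hi hi' => ?_⟩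
    · rw [key, h1, hz (K + 1 + (m + 1)) (by omega), smul_zero, add_zero]
    · rw [key, hz _ (by omega : K + 1 ≤ K + (m + 1)), smul_zero, add_zero, h2]
    · rw [key]
      by_cases him : K ≤ i + m
      · rw [hz (i + (m + 1)) (by omega), smul_zero, add_zero, h3 i hi him]
      · obtain rfl : i = K - (m + 1) := by omega
        rw [Nat.sub_add_cancel (by omega)]
        simp [h2]

/-- Normalisation of a chain against the Hermitian form, for a real eigenvalue. -/
lemma exists_hermitian_normal (r : ℝ) (K : ℕ) (η : ℝ) (hη : η = 1 ∨ η = -1) (u : V)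
    (hu : (D.shift r ^ (K + 1)) u = 0) (hφ : D.h u ((D.shift r ^ K) u) = η) (m : ℕ) :
    ∃ u', (D.shift r ^ (K + 1)) u' = 0 ∧ D.h u' ((D.shift r ^ K) u') = η ∧
      ∀ i, i < K → K ≤ i + m → D.h u' ((D.shift r ^ i) u') = 0 := by
  induction m with
  | zero => exact ⟨u, hu, hφ, fun i h1 h2 => by omega⟩
  | succ m ih =>
    obtain ⟨u', h1, h2, h3⟩ := ih
    by_cases hm : K < m + 1
    · exact ⟨u', h1, h2, fun i hi _ => h3 i hi (by omega)⟩
    set N := D.shift r with hN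
    have hz : ∀ j, K + 1 ≤ j → (N ^ j) u' = 0 := fun j hj => by
      obtain ⟨c, rfl⟩ := Nat.exists_eq_add_of_le' hj
      rw [pow_add, Module.End.mul_apply, h1, map_zero]
    have hadj : ∀ k x y, D.h ((N ^ k) x) y = D.h x ((N ^ k) y) := fun k x y => by
      rw [hN, D.h_shift_pow, Complex.conj_ofReal]
    have hreal : ∀ i, starRingEnd ℂ (D.h u' ((N ^ i) u')) = D.h u' ((N ^ i) u') := fun i => by
      rw [D.h_symm, hadj]
    obtain ⟨c, hc⟩ := Complex.conj_eq_iff_real.mp (hreal (K - (m + 1)))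
    have key : ∀ i (t : ℝ), (N ^ i) (u' + (t : ℂ) • (N ^ (m + 1)) u') =
        (N ^ i) u' + (t : ℂ) • (N ^ (i + (m + 1))) u' := fun i t => by
      rw [map_add, map_smul, pow_add N i, Module.End.mul_apply]
    have key2 : ∀ i (t : ℝ), D.h (u' + (t : ℂ) • (N ^ (m + 1)) u')
        ((N ^ i) (u' + (t : ℂ) • (N ^ (m + 1)) u')) =
        D.h u' ((N ^ i) u') + 2 * t * D.h u' ((N ^ (i + (m + 1))) u') +
          t ^ 2 * D.h u' ((N ^ (i + (m + 1) + (m + 1))) u') := fun i t => by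
      have e1 : (N ^ (m + 1)) ((N ^ i) u') = (N ^ (i + (m + 1))) u' := by
        rw [← Module.End.mul_apply, ← pow_add, add_comm]
      have e2 : (N ^ (m + 1)) ((N ^ (i + (m + 1))) u') = (N ^ (i + (m + 1) + (m + 1))) u' := by
        rw [← Module.End.mul_apply, ← pow_add, add_comm]
      rw [key]
      simp only [D.h_add_left, D.h_smul_left, map_add, map_smul, smul_eq_mul, hadj, e1, e2,
        Complex.conj_ofReal]
      ring
    have hη2 : (η : ℂ) * η = 1 := by rcases hη with rfl | rfl <;> simp
    refine ⟨u' + ((-(c * η / 2) : ℝ) : ℂ) • (N ^ (m + 1)) u', ?_, ?_, fun i hi hi' => ?_⟩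
    · rw [key, h1, hz (K + 1 + (m + 1)) (by omega), smul_zero, add_zero]
    · rw [key2, h2, hz _ (by omega : K + 1 ≤ K + (m + 1)),
        hz _ (by omega : K + 1 ≤ K + (m + 1) + (m + 1))]
      simp
    · rw [key2]
      by_cases him : K ≤ i + m
      · rw [h3 i hi him, hz _ (by omega : K + 1 ≤ i + (m + 1)),
          hz _ (by omega : K + 1 ≤ i + (m + 1) + (m + 1))]
        simp
      · obtain rfl : i = K - (m + 1) := by omega
        rw [Nat.sub_add_cancel (by omega), hz (K + (m + 1)) (by omega), h2, hc]
        push_cast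
        simp only [map_zero]
        linear_combination (-(c : ℂ)) * hη2

/-- Polarisation: a real root space carries a vector of full height and nonzero norm. -/
lemma exists_polarized (r : ℝ) (K : ℕ) (u z : V) (hu : (D.shift r ^ (K + 1)) u = 0)
    (hz : (D.shift r ^ (K + 1)) z = 0) (hne : D.h z ((D.shift r ^ K) u) ≠ 0) :
    ∃ x, (D.shift r ^ (K + 1)) x = 0 ∧
      (D.h x ((D.shift r ^ K) x) = ((1 : ℝ) : ℂ) ∨ D.h x ((D.shift r ^ K) x) = ((-1 : ℝ) : ℂ)) := by
  set N := D.shift r with hN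
  have hadj : ∀ k x y, D.h ((N ^ k) x) y = D.h x ((N ^ k) y) := fun k x y => by
    rw [hN, D.h_shift_pow, Complex.conj_ofReal]
  have hex : ∃ x, (N ^ (K + 1)) x = 0 ∧ D.h x ((N ^ K) x) ≠ 0 := by
    by_contra! hc
    set c := D.h z ((N ^ K) u) with hcdef
    have hc' : D.h u ((N ^ K) z) = starRingEnd ℂ c := by rw [hcdef, D.h_symm, hadj]
    have h1 := hc z hz
    have h2 := hc u hu
    have h3 := hc (z + starRingEnd ℂ c • u) (by rw [map_add, map_smul, hz, hu]; simp)
    simp only [D.h_add_left, D.h_smul_left, map_add, map_smul, smul_eq_mul, h1, h2, hc',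
      ← hcdef, Complex.conj_conj] at h3
    have h4 : c * starRingEnd ℂ c = 0 := by linear_combination h3 / 2
    rcases mul_eq_zero.mp h4 with h5 | h5
    · exact hne h5
    · exact hne ((map_eq_zero _).mp h5)
  obtain ⟨x, hx, hx0⟩ := hex
  obtain ⟨c, hc⟩ := Complex.conj_eq_iff_real.mp
    (show starRingEnd ℂ (D.h x ((N ^ K) x)) = _ by rw [D.h_symm, hadj])
  have hc0 : c ≠ 0 := by
    rintro rfl
    exact hx0 (by simpa using hc)
  have hs : (Real.sqrt |c|)⁻¹ * (Real.sqrt |c|)⁻¹ * c = c / |c| := by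
    rw [← mul_inv, Real.mul_self_sqrt (abs_nonneg c)]
    ring
  refine ⟨(((Real.sqrt |c|)⁻¹ : ℝ) : ℂ) • x, by rw [map_smul, hx, smul_zero], ?_⟩
  have e : D.h ((((Real.sqrt |c|)⁻¹ : ℝ) : ℂ) • x) ((N ^ K) ((((Real.sqrt |c|)⁻¹ : ℝ) : ℂ) • x)) =
      ((c / |c| : ℝ) : ℂ) := by
    rw [← hs, D.h_smul_left, map_smul, map_smul, hc, Complex.conj_ofReal, smul_eq_mul]
    push_cast
    ring
  rw [e]
  rcases lt_or_gt_of_ne hc0 with h | h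
  · right
    rw [abs_of_neg h, div_neg, div_self hc0]
  · left
    rw [abs_of_pos h, div_self hc0]

end QuatSpace

lemma sip_apply_rev (k : ℕ) (i j : Fin k) : sip ℂ k i j = if j = i.rev then 1 else 0 := by
  have : ((i : ℕ) + (j : ℕ) = k - 1) ↔ j = i.rev := by
    rw [Fin.ext_iff, Fin.val_rev]
    omega
  simp only [sip, Matrix.of_apply, this]

lemma sip_mul_sip (k : ℕ) : sip ℂ k * sip ℂ k = 1 := by
  ext i j
  rw [Matrix.mul_apply, Finset.sum_eq_single i.rev (fun m _ hm => by simp [sip_apply_rev, hm])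
    (by simp)]
  simp [sip_apply_rev, Matrix.one_apply, eq_comm]

lemma jordanBlock_map_conj (lam : ℂ) (k : ℕ) (i j : Fin k) :
    starRingEnd ℂ (jordanBlock lam k i j) = jordanBlock (starRingEnd ℂ lam) k i j := by
  simp only [jordanBlock, Matrix.of_apply]
  split_ifs <;> simp

lemma dsum2_map_conj {k : ℕ} (M N : Matrix (Fin k) (Fin k) ℂ) (i j : Fin (2 * k)) :
    starRingEnd ℂ (dsum2 M N i j) =
      dsum2 (M.map (starRingEnd ℂ)) (N.map (starRingEnd ℂ)) i j := by
  simp only [dsum2, Matrix.reindex_apply, Matrix.submatrix_apply]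
  rcases (finTwoMul k).symm i with i | i <;> rcases (finTwoMul k).symm j with j | j <;> simp

lemma sum_jordanBlock_smul {V : Type} [AddCommGroup V] [Module ℂ V] (A : Module.End ℂ V)
    (lam : ℂ) (K : ℕ) (u : V) (hu : ((A - lam • 1) ^ (K + 1)) u = 0) (j : Fin (K + 1)) :
    A (((A - lam • 1) ^ (K - (j : ℕ))) u) =
      ∑ i : Fin (K + 1), jordanBlock lam (K + 1) i j • ((A - lam • 1) ^ (K - (i : ℕ))) u := by
  set N := A - lam • 1 with hN
  have hA : ∀ x, A x = lam • x + N x := fun x => by simp [hN]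
  have hJ : ∀ i : Fin (K + 1), jordanBlock lam (K + 1) i j =
      (if i = j then lam else 0) + (if (i : ℕ) + 1 = (j : ℕ) then 1 else 0) := fun i => by
    simp only [jordanBlock, Matrix.of_apply, Fin.ext_iff]
    split_ifs <;> first | omega | simp
  simp only [hJ, add_smul, Finset.sum_add_distrib, ite_smul, zero_smul, Finset.sum_ite_eq',
    Finset.mem_univ, if_true, one_smul]
  rw [hA]
  congr 1
  rw [← Module.End.mul_apply, ← pow_succ']
  refine Fin.cases ?_ (fun j' => ?_) j
  · simp [hu]
  · rw [Finset.sum_eq_single j'.castSucc]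
    · have : K - (j' : ℕ) = K - ((j' : ℕ) + 1) + 1 := by have := j'.2; omega
      simp [this]
    · intro b _ hb
      rw [if_neg]
      intro h
      apply hb
      ext
      simpa using h
    · simp

/-- A finite sequence of vectors together with the matrices meant to represent the operator and
the Gram matrix on it. -/
structure Block (V : Type) where
  size : ℕ
  J : Matrix (Fin size) (Fin size) ℂ
  G : Matrix (Fin size) (Fin size) ℂ
  v : Fin size → V

/-- The canonical block for a real eigenvalue. -/
def realBlock {V : Type} (k : ℕ) (r η : ℝ) (v : Fin k → V) : Block V :=
  ⟨k, jordanBlock (r : ℂ) k, η • sip ℂ k, v⟩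

/-- The canonical block for a pair of conjugate eigenvalues. -/
def cplxBlock {V : Type} (l : ℕ) (z : ℂ) (v : Fin (2 * l) → V) : Block V :=
  ⟨2 * l, dsum2 (jordanBlock z l) (jordanBlock (starRingEnd ℂ z) l), sip ℂ (2 * l), v⟩

/-- The block has real type with sign `±1`. -/
def Block.IsReal {V : Type} (B : Block V) : Prop :=
  ∃ (k : ℕ) (r η : ℝ) (v : Fin k → V), (η = 1 ∨ η = -1) ∧ B = realBlock k r η v

/-- The block has the type of a pair of nonreal eigenvalues. -/
def Block.IsCplx {V : Type} (B : Block V) : Prop :=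
  ∃ (l : ℕ) (z : ℂ) (v : Fin (2 * l) → V), 0 < z.im ∧ B = cplxBlock l z v

namespace QuatSpace

variable {V : Type} [AddCommGroup V] [Module ℂ V] (D : QuatSpace V)

/-- The matrices of the block represent the operator and the form on its vectors. -/
structure IsBlock (B : Block V) : Prop where
  A_v : ∀ j, D.A (B.v j) = ∑ i, B.J i j • B.v i
  gram : ∀ i j, D.h (B.v i) (B.v j) = B.G i j
  gram_σ : ∀ i j, D.h (B.v i) (D.σ (B.v j)) = 0
  G_sq : B.G * B.G = 1

lemma exists_realBlock {r : ℝ} {K : ℕ} {u z : V} (hu : (D.shift r ^ (K + 1)) u = 0)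
    (hz : (D.shift r ^ (K + 1)) z = 0) (hne : D.h z ((D.shift r ^ K) u) ≠ 0) :
    ∃ B : Block V, B.IsReal ∧ 0 < B.size ∧ D.IsBlock B := by
  obtain ⟨x, hx, hxη⟩ := D.exists_polarized r K u z hu hz hne
  obtain ⟨η, hη, hxη⟩ : ∃ η : ℝ, (η = 1 ∨ η = -1) ∧ D.h x ((D.shift r ^ K) x) = η := by
    rcases hxη with h | h
    exacts [⟨1, .inl rfl, h⟩, ⟨-1, .inr rfl, h⟩]
  obtain ⟨x, hx, hxη, h0⟩ := D.exists_hermitian_normal r K η hη x hx hxη K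
  have hz : ∀ j, K + 1 ≤ j → (D.shift r ^ j) x = 0 := fun j hj => by
    obtain ⟨c, rfl⟩ := Nat.exists_eq_add_of_le' hj
    rw [pow_add, Module.End.mul_apply, hx, map_zero]
  have hadj : ∀ i j y, D.h ((D.shift r ^ i) x) ((D.shift r ^ j) y) =
      D.h x ((D.shift r ^ (i + j)) y) := fun i j y => by
    rw [D.h_shift_pow, Complex.conj_ofReal, pow_add, Module.End.mul_apply]
  refine ⟨realBlock (K + 1) r η fun i => (D.shift r ^ (K - (i : ℕ))) x,
    ⟨_, r, η, _, hη, rfl⟩, Nat.succ_pos K, ⟨?_, ?_, ?_, ?_⟩⟩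
  · exact fun j => sum_jordanBlock_smul D.A r K x hx j
  · intro i j
    change Fin (K + 1) at i j
    change D.h ((D.shift r ^ (K - (i : ℕ))) x) ((D.shift r ^ (K - (j : ℕ))) x) =
      (η • sip ℂ (K + 1)) i j
    rw [hadj, Matrix.smul_apply]
    simp only [sip, Matrix.of_apply, Nat.add_sub_cancel]
    have hi := i.2
    have hj := j.2
    split_ifs with h
    · rw [show K - (i : ℕ) + (K - (j : ℕ)) = K by omega, hxη]
      simp
    · rw [smul_zero]
      by_cases h' : K < K - (i : ℕ) + (K - (j : ℕ))
      · rw [hz _ h', map_zero]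
      · exact h0 _ (by omega) (by omega)
  · intro i j
    change Fin (K + 1) at i j
    change D.h ((D.shift r ^ (K - (i : ℕ))) x) (D.σ ((D.shift r ^ (K - (j : ℕ))) x)) = 0
    have h1 : ∀ m, D.h x ((D.shift r ^ m) (D.σ x)) = 0 := fun m => by
      have h2 := D.h_σ_right x ((D.shift r ^ m) x)
      rw [D.h_shift_pow] at h2
      have h3 := D.shift_pow_σ r m x
      rw [Complex.conj_ofReal] at h2 h3
      rw [← h3] at h2
      exact self_eq_neg.mp h2
    have h3 := D.shift_pow_σ r (K - (j : ℕ)) x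
    rw [Complex.conj_ofReal] at h3
    rw [← h3, hadj, h1]
  · change (η • sip ℂ (K + 1)) * (η • sip ℂ (K + 1)) = 1
    rw [Matrix.smul_mul, Matrix.mul_smul, sip_mul_sip, smul_smul]
    rcases hη with rfl | rfl <;> simp

lemma exists_cplxBlock {lam : ℂ} (hlam : 0 < lam.im) {K : ℕ} {u y : V}
    (hu : (D.shift lam ^ (K + 1)) u = 0) (hy : (D.shift lam ^ (K + 1)) y = 0)
    (hne : D.h (D.σ y) ((D.shift lam ^ K) u) ≠ 0) :
    ∃ B : Block V, B.IsCplx ∧ 0 < B.size ∧ D.IsBlock B := by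
  have hlne : starRingEnd ℂ lam ≠ lam := by
    rw [Ne, Complex.conj_eq_iff_im]
    exact hlam.ne'
  obtain ⟨u, hu, hu1, h0⟩ := exists_linear_normal (D.shift lam) (D.h (D.σ y)) K
    ((D.h (D.σ y) ((D.shift lam ^ K) u))⁻¹ • u) (by rw [map_smul, hu, smul_zero])
    (by rw [map_smul, map_smul, smul_eq_mul, inv_mul_cancel₀ hne]) K
  set N := D.shift lam with hN
  have hker : ∀ {x : V} (m : ℕ), (N ^ (K + 1)) x = 0 → (N ^ (K + 1)) ((N ^ m) x) = 0 :=
    fun m hx => by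
      rw [← Module.End.mul_apply, ← pow_add, add_comm, pow_add, Module.End.mul_apply, hx, map_zero]
  have hz : ∀ j, K + 1 ≤ j → (N ^ j) u = 0 := fun j hj => by
    obtain ⟨c, rfl⟩ := Nat.exists_eq_add_of_le' hj
    rw [pow_add, Module.End.mul_apply, hu, map_zero]
  have hadj : ∀ i j (x x' : V), D.h (D.σ ((N ^ i) x)) ((N ^ j) x') =
      D.h (D.σ x) ((N ^ (i + j)) x') := fun i j x x' => by
    have h1 := D.shift_pow_σ (starRingEnd ℂ lam) i x
    rw [Complex.conj_conj] at h1
    rw [hN, ← h1, D.h_shift_pow, Complex.conj_conj, pow_add, Module.End.mul_apply]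
  have halt : ∀ i j (x : V), D.h (D.σ ((N ^ i) x)) ((N ^ j) x) = 0 := fun i j x => by
    have h2 := D.h_σ_right ((N ^ j) x) ((N ^ i) x)
    rw [← D.h_symm, ← D.h_symm ((D.σ ((N ^ j) x))), hadj, hadj, add_comm j i, ← map_neg] at h2
    rw [hadj]
    exact self_eq_neg.mp ((starRingEnd ℂ).injective h2)
  have hiso : ∀ i j {x x' : V}, (N ^ (K + 1)) x = 0 → (N ^ (K + 1)) x' = 0 →
      D.h ((N ^ i) x) ((N ^ j) x') = 0 := fun i j x x' hx hx' =>
    D.h_eq_zero_of_pow hlne _ _ _ rfl _ _ (hker i hx) (hker j hx')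
  have hmain : ∀ i j : Fin (K + 1), D.h (D.σ ((N ^ (K - (i : ℕ))) y)) ((N ^ (K - (j : ℕ))) u) =
      if (i : ℕ) + (j : ℕ) = K then 1 else 0 := fun i j => by
    have hi := i.2
    have hj := j.2
    rw [hadj]
    split_ifs with h
    · rw [show K - (i : ℕ) + (K - (j : ℕ)) = K by omega, hu1]
    · by_cases h' : K < K - (i : ℕ) + (K - (j : ℕ))
      · rw [hz _ h', map_zero]
      · exact h0 _ (by omega) (by omega)
  let w : Fin (K + 1) ⊕ Fin (K + 1) → V :=
    Sum.elim (fun i => (N ^ (K - (i : ℕ))) u) (fun i => D.σ ((N ^ (K - (i : ℕ))) y))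
  refine ⟨cplxBlock (K + 1) lam fun p => w ((finTwoMul (K + 1)).symm p),
    ⟨_, lam, _, hlam, rfl⟩, by simp [cplxBlock], ⟨?_, ?_, ?_, ?_⟩⟩
  · intro p
    change Fin (2 * (K + 1)) at p
    change D.A (w ((finTwoMul (K + 1)).symm p)) = ∑ q : Fin (2 * (K + 1)),
      dsum2 (jordanBlock lam (K + 1)) (jordanBlock (starRingEnd ℂ lam) (K + 1)) q p •
        w ((finTwoMul (K + 1)).symm q)
    obtain ⟨p, rfl⟩ := (finTwoMul (K + 1)).surjective p
    rw [← Equiv.sum_comp (finTwoMul (K + 1))]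
    simp only [dsum2, Matrix.reindex_apply, Matrix.submatrix_apply, Equiv.symm_apply_apply,
      Fintype.sum_sum_type]
    rcases p with p | p
    · simpa [w, hN, shift] using sum_jordanBlock_smul D.A lam K u hu p
    · have h1 := congrArg D.σ (sum_jordanBlock_smul D.A lam K y hy p)
      rw [map_sum, ← D.A_σ] at h1
      simpa [w, hN, shift, jordanBlock_map_conj] using h1
  · intro p q
    change Fin (2 * (K + 1)) at p q
    change D.h (w ((finTwoMul (K + 1)).symm p)) (w ((finTwoMul (K + 1)).symm q)) =
      sip ℂ (2 * (K + 1)) p q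
    obtain ⟨p, rfl⟩ := (finTwoMul (K + 1)).surjective p
    obtain ⟨q, rfl⟩ := (finTwoMul (K + 1)).surjective q
    rw [Equiv.symm_apply_apply, Equiv.symm_apply_apply]
    rcases p with p | p <;> rcases q with q | q
    · have hp := p.2
      have hq := q.2
      simp only [w, Sum.elim_inl, hiso _ _ hu hu, sip, finTwoMul, Matrix.of_apply]
      rw [if_neg]
      simp
      omega
    · have hp := p.2
      have hq := q.2
      simp only [w, Sum.elim_inl, Sum.elim_inr, sip, finTwoMul, Matrix.of_apply]
      rw [← D.h_symm, hmain, apply_ite (starRingEnd ℂ), map_one, map_zero]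
      congr 1
      simp
      omega
    · have hp := p.2
      have hq := q.2
      simp only [w, Sum.elim_inl, Sum.elim_inr, sip, finTwoMul, Matrix.of_apply]
      rw [hmain]
      congr 1
      simp
      omega
    · have hp := p.2
      have hq := q.2
      simp only [w, Sum.elim_inr, D.h_σ, hiso _ _ hy hy, sip, finTwoMul, Matrix.of_apply]
      rw [if_neg]
      · simp
      · simp
        omega
  · intro p q
    change Fin (2 * (K + 1)) at p q
    change D.h (w ((finTwoMul (K + 1)).symm p)) (D.σ (w ((finTwoMul (K + 1)).symm q))) = 0
    rcases (finTwoMul (K + 1)).symm p with p | p <;> rcases (finTwoMul (K + 1)).symm q with q | q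
    · exact D.h_zero_comm (halt _ _ u)
    · simp only [w, Sum.elim_inl, Sum.elim_inr, D.σ_σ, map_neg, hiso _ _ hu hy, neg_zero]
    · simp only [w, Sum.elim_inl, Sum.elim_inr, D.h_σ, hiso _ _ hy hu, map_zero]
    · simp only [w, Sum.elim_inr, D.σ_σ, map_neg, halt, neg_zero]
  · exact sip_mul_sip _

lemma exists_block [FiniteDimensional ℂ V] [Nontrivial V] :
    ∃ B : Block V, (B.IsReal ∨ B.IsCplx) ∧ 0 < B.size ∧ D.IsBlock B := by
  obtain ⟨μ, hμ⟩ := Module.End.exists_eigenvalue D.A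
  obtain ⟨x, hx⟩ := hμ.exists_hasEigenvector
  have hx1 : D.A x = μ • x := hx.apply_eq_smul
  have key : ∃ lam : ℂ, 0 ≤ lam.im ∧ ∃ x : V, x ≠ 0 ∧ D.A x = lam • x := by
    rcases le_or_gt 0 μ.im with h | h
    · exact ⟨μ, h, x, hx.2, hx1⟩
    · refine ⟨starRingEnd ℂ μ, by simpa using h.le, D.σ x, fun h0 => hx.2 ?_, ?_⟩
      · rw [← neg_neg x, ← D.σ_σ x, h0, map_zero, neg_zero]
      · rw [D.A_σ, hx1, map_smulₛₗ]
  obtain ⟨lam, hlam, hex⟩ := key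
  obtain ⟨K, u, y, hu, hy, hne⟩ := D.exists_top hex
  rcases hlam.eq_or_lt with h | h
  · obtain ⟨r, rfl⟩ : ∃ r : ℝ, lam = r := ⟨lam.re, Complex.ext (by simp) (by simp [← h])⟩
    have hy' : (D.shift r ^ (K + 1)) (D.σ y) = 0 := by
      rw [shift_pow_σ, Complex.conj_ofReal, hy, map_zero]
    obtain ⟨B, h1, h2⟩ := D.exists_realBlock hu hy' hne
    exact ⟨B, .inl h1, h2⟩
  · obtain ⟨B, h1, h2⟩ := D.exists_cplxBlock h hu hy hne
    exact ⟨B, .inr h1, h2⟩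

end QuatSpace

namespace QuatSpace

variable {V : Type} [AddCommGroup V] [Module ℂ V] (D : QuatSpace V)

/-- Restriction to an invariant nondegenerate subspace. -/
def restrict (U : Submodule ℂ V) (hA : ∀ x ∈ U, D.A x ∈ U) (hσ : ∀ x ∈ U, D.σ x ∈ U)
    (hU : ∀ x ∈ U, (∀ y ∈ U, D.h y x = 0) → x = 0) : QuatSpace U where
  A := D.A.restrict hA
  σ :=
    { toFun := fun x => ⟨D.σ x, hσ x x.2⟩
      map_add' := fun x y => Subtype.ext (by simp)
      map_smul' := fun c x => Subtype.ext (by simp) }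
  h := fun x => (D.h x).comp U.subtype
  σ_σ := fun x => Subtype.ext (D.σ_σ x)
  A_σ := fun x => Subtype.ext (D.A_σ x)
  h_symm := fun x y => D.h_symm x y
  h_σ := fun x y => D.h_σ x y
  h_A := fun x y => D.h_A x y
  nondeg := fun x hx => Subtype.ext (hU x x.2 fun y hy => hx ⟨y, hy⟩)

/-- Pairing a vector with the vectors of a block and with their images under `σ`. -/
def pairing (B : Block V) : V →ₗ[ℂ] (Fin B.size ⊕ Fin B.size → ℂ) :=
  LinearMap.pi (Sum.elim (fun i => D.h (B.v i)) (fun i => D.h (D.σ (B.v i))))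

lemma mem_ker_pairing {B : Block V} {x : V} : x ∈ LinearMap.ker (D.pairing B) ↔
    (∀ i, D.h (B.v i) x = 0) ∧ ∀ i, D.h (D.σ (B.v i)) x = 0 := by
  rw [LinearMap.mem_ker, funext_iff, Sum.forall]
  rfl

variable {D}

lemma IsBlock.exists_pairing_eq {B : Block V} (hB : D.IsBlock B)
    (c : Fin B.size ⊕ Fin B.size → ℂ) :
    ∃ w, D.pairing B w = c ∧ ∀ x ∈ LinearMap.ker (D.pairing B), D.h w x = 0 := by
  refine ⟨∑ j, (B.G *ᵥ fun i => c (.inl i)) j • B.v j +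
    ∑ j, (B.G.map (starRingEnd ℂ) *ᵥ fun i => c (.inr i)) j • D.σ (B.v j), ?_, fun x hx => ?_⟩
  · have hG' : B.G.map (starRingEnd ℂ) * B.G.map (starRingEnd ℂ) = 1 := by
      rw [← Matrix.map_mul, hB.G_sq, Matrix.map_one _ (map_zero _) (map_one _)]
    funext p
    rcases p with p | p
    · change D.h (B.v p) _ = _
      simp only [map_add, map_sum, map_smul, hB.gram, hB.gram_σ, mul_zero, Finset.sum_const_zero,
        add_zero, smul_eq_mul]
      calc ∑ j, (B.G *ᵥ fun i => c (.inl i)) j * B.G p j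
          = (B.G *ᵥ (B.G *ᵥ fun i => c (.inl i))) p := by
            simp only [Matrix.mulVec, dotProduct, mul_comm]
        _ = c (.inl p) := by rw [Matrix.mulVec_mulVec, hB.G_sq, Matrix.one_mulVec]
    · change D.h (D.σ (B.v p)) _ = _
      simp only [map_add, map_sum, map_smul, D.h_σ, hB.gram, D.h_zero_comm (hB.gram_σ _ _),
        mul_zero, Finset.sum_const_zero, zero_add, smul_eq_mul]
      calc ∑ j, (B.G.map (starRingEnd ℂ) *ᵥ fun i => c (.inr i)) j * starRingEnd ℂ (B.G p j)
          = (B.G.map (starRingEnd ℂ) *ᵥ (B.G.map (starRingEnd ℂ) *ᵥ fun i => c (.inr i))) p := by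
            simp only [Matrix.mulVec, dotProduct, mul_comm, Matrix.map_apply]
        _ = c (.inr p) := by rw [Matrix.mulVec_mulVec, hG', Matrix.one_mulVec]
  · rw [mem_ker_pairing] at hx
    simp [D.h_add_left, D.h_sum_left, D.h_smul_left, hx.1, hx.2]

lemma IsBlock.finrank_ker_pairing [FiniteDimensional ℂ V] {B : Block V} (hB : D.IsBlock B) :
    2 * B.size + Module.finrank ℂ (LinearMap.ker (D.pairing B)) = Module.finrank ℂ V := by
  rw [← LinearMap.finrank_range_add_finrank_ker (D.pairing B), LinearMap.range_eq_top.mpr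
    fun c => (hB.exists_pairing_eq c).imp fun _ h => h.1]
  simp [two_mul]

lemma IsBlock.A_mem_ker {B : Block V} (hB : D.IsBlock B) :
    ∀ x ∈ LinearMap.ker (D.pairing B), D.A x ∈ LinearMap.ker (D.pairing B) := by
  intro x hx
  rw [mem_ker_pairing] at hx ⊢
  constructor <;> intro i
  · rw [← D.h_A, hB.A_v]
    simp [D.h_sum_left, D.h_smul_left, hx.1]
  · rw [← D.h_A, D.A_σ, hB.A_v]
    simp [D.h_sum_left, D.h_smul_left, hx.2]

lemma σ_mem_ker {B : Block V} :
    ∀ x ∈ LinearMap.ker (D.pairing B), D.σ x ∈ LinearMap.ker (D.pairing B) := by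
  intro x hx
  rw [mem_ker_pairing] at hx ⊢
  constructor <;> intro i
  · rw [D.h_σ_right, D.h_zero_comm (hx.2 i), neg_zero]
  · rw [D.h_σ, hx.1, map_zero]

lemma IsBlock.nondeg_ker {B : Block V} (hB : D.IsBlock B) :
    ∀ x ∈ LinearMap.ker (D.pairing B), (∀ y ∈ LinearMap.ker (D.pairing B), D.h y x = 0) →
      x = 0 := by
  intro x hx h
  refine D.nondeg x fun z => ?_
  obtain ⟨w, hw, hw0⟩ := hB.exists_pairing_eq (D.pairing B z)
  have h1 := h (z - w) (by rw [LinearMap.mem_ker, map_sub, hw, sub_self])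
  rw [← sub_add_cancel z w, D.h_add_left, h1, hw0 x hx, add_zero]

variable (D)

/-- The quaternionic spans of two blocks are orthogonal. -/
def Orth (B C : Block V) : Prop :=
  (∀ i j, D.h (B.v i) (C.v j) = 0) ∧ ∀ i j, D.h (B.v i) (D.σ (C.v j)) = 0

lemma Orth.symm {B C : Block V} (h : D.Orth B C) : D.Orth C B :=
  ⟨fun i j => D.h_zero_comm (h.1 j i), fun i j => by rw [D.h_σ_right, h.2, neg_zero]⟩

end QuatSpace

/-- Image of a block under a map of vectors. -/
def Block.map {V W : Type} (f : V → W) (B : Block V) : Block W := ⟨B.size, B.J, B.G, f ∘ B.v⟩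

lemma Block.IsReal.map {V W : Type} (f : V → W) {B : Block V} (h : B.IsReal) :
    (B.map f).IsReal := by
  obtain ⟨k, r, η, v, hη, rfl⟩ := h
  exact ⟨k, r, η, f ∘ v, hη, rfl⟩

lemma Block.IsCplx.map {V W : Type} (f : V → W) {B : Block V} (h : B.IsCplx) :
    (B.map f).IsCplx := by
  obtain ⟨l, z, v, hz, rfl⟩ := h
  exact ⟨l, z, f ∘ v, hz, rfl⟩

/-- Orthogonal decomposition of a quaternionic space into canonical blocks. -/
theorem QuatSpace.exists_family (N : ℕ) : ∀ (V : Type) [AddCommGroup V] [Module ℂ V]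
    [FiniteDimensional ℂ V] (D : QuatSpace V), Module.finrank ℂ V = N →
    ∃ (ι : Type) (_ : Fintype ι) (F : ι → Block V), (∀ i, (F i).IsReal ∨ (F i).IsCplx) ∧
      (∀ i, D.IsBlock (F i)) ∧ (∀ i j, i ≠ j → D.Orth (F i) (F j)) ∧
      2 * ∑ i, (F i).size = N := by
  induction N using Nat.strong_induction_on with
  | _ N ih =>
    intro V _ _ _ D hN
    rcases subsingleton_or_nontrivial V with hV | hV
    · refine ⟨Empty, inferInstance, Empty.elim, fun i => i.elim, fun i => i.elim,
        fun i => i.elim, ?_⟩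
      rw [← hN, Module.finrank_zero_of_subsingleton]
      rfl
    · obtain ⟨B, hB1, hB0, hB⟩ := D.exists_block
      have hdim := hB.finrank_ker_pairing
      obtain ⟨ι, _, F, h1, h2, h3, h4⟩ := ih _ (by omega) (LinearMap.ker (D.pairing B))
        (D.restrict _ hB.A_mem_ker σ_mem_ker hB.nondeg_ker) rfl
      have hperp : ∀ i, D.Orth B ((F i).map Subtype.val) := fun i =>
        ⟨fun p q => (D.mem_ker_pairing.mp ((F i).v q).2).1 p,
          fun p q => (D.mem_ker_pairing.mp (σ_mem_ker _ ((F i).v q).2)).1 p⟩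
      refine ⟨Option ι, inferInstance, fun o => o.elim B fun i => (F i).map Subtype.val,
        ?_, ?_, ?_, ?_⟩
      · rintro (_ | i)
        · exact hB1
        · exact (h1 i).imp (fun h => h.map _) fun h => h.map _
      · rintro (_ | i)
        · exact hB
        · refine ⟨fun j => ?_, fun j k => (h2 i).gram j k, fun j k => (h2 i).gram_σ j k,
            (h2 i).G_sq⟩
          have := congrArg Subtype.val ((h2 i).A_v j)
          rw [AddSubmonoidClass.coe_finsetSum] at this
          exact this
      · rintro (_ | i) (_ | j) hij
        · exact absurd rfl hij
        · exact hperp j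
        · exact (hperp i).symm
        · have := h3 i j (fun h => hij (h ▸ rfl))
          exact ⟨fun p q => this.1 p q, fun p q => this.2 p q⟩
      · rw [Fintype.sum_option, mul_add, ← hN, ← hdim, ← h4]
        rfl

/-- The conjugate-linear structure map of `ℂ^{2n}` commuting with the matrices of `Ω_{2n}`. -/
def omegaConj (n : ℕ) : (Fin (2 * n) → ℂ) →ₛₗ[starRingEnd ℂ] (Fin (2 * n) → ℂ) where
  toFun x p := Sum.elim (fun i => -starRingEnd ℂ (x (finTwoMul n (.inr i))))
    (fun i => starRingEnd ℂ (x (finTwoMul n (.inl i)))) ((finTwoMul n).symm p)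
  map_add' x y := by
    funext p
    rcases h : (finTwoMul n).symm p with i | i <;> simp [h, add_comm]
  map_smul' c x := by
    funext p
    rcases h : (finTwoMul n).symm p with i | i <;> simp [h]

lemma omegaConj_inl {n : ℕ} (x : Fin (2 * n) → ℂ) (i : Fin n) :
    omegaConj n x (finTwoMul n (.inl i)) = -starRingEnd ℂ (x (finTwoMul n (.inr i))) := by
  simp [omegaConj]

lemma omegaConj_inr {n : ℕ} (x : Fin (2 * n) → ℂ) (i : Fin n) :
    omegaConj n x (finTwoMul n (.inr i)) = starRingEnd ℂ (x (finTwoMul n (.inl i))) := by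
  simp [omegaConj]

lemma finTwoMul_forall {n : ℕ} {P : Fin (2 * n) → Prop} :
    (∀ p, P p) ↔ (∀ i, P (finTwoMul n (.inl i))) ∧ ∀ i, P (finTwoMul n (.inr i)) := by
  rw [← (finTwoMul n).forall_congr_right, Sum.forall]

lemma finTwoMul_sum {n : ℕ} (f : Fin (2 * n) → ℂ) :
    ∑ p, f p = ∑ i, f (finTwoMul n (.inl i)) + ∑ i, f (finTwoMul n (.inr i)) := by
  rw [← Equiv.sum_comp (finTwoMul n), Fintype.sum_sum_type]

lemma omegaConj_omegaConj {n : ℕ} (x : Fin (2 * n) → ℂ) :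
    omegaConj n (omegaConj n x) = -x := by
  rw [funext_iff, finTwoMul_forall]
  simp [omegaConj_inl, omegaConj_inr]

lemma InOmega.mulVec_omegaConj {n : ℕ} {M : Matrix (Fin (2 * n)) (Fin (2 * n)) ℂ}
    (hM : InOmega M) (x : Fin (2 * n) → ℂ) :
    M *ᵥ omegaConj n x = omegaConj n (M *ᵥ x) := by
  obtain ⟨A₁, A₂, rfl⟩ := hM
  rw [funext_iff, finTwoMul_forall]
  constructor <;> intro i
  · rw [omegaConj_inl]
    simp only [Matrix.mulVec, dotProduct, finTwoMul_sum, omegaConj_inl, omegaConj_inr, omegaMap,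
      Matrix.reindex_apply, Matrix.submatrix_apply, Equiv.symm_apply_apply,
      Matrix.fromBlocks_apply₁₁, Matrix.fromBlocks_apply₁₂, Matrix.fromBlocks_apply₂₁,
      Matrix.fromBlocks_apply₂₂, Matrix.map_apply, Matrix.neg_apply, map_add, map_sum, map_mul,
      map_neg, Complex.conj_conj, neg_mul, mul_neg, Finset.sum_neg_distrib]
    ring
  · rw [omegaConj_inr]
    simp only [Matrix.mulVec, dotProduct, finTwoMul_sum, omegaConj_inl, omegaConj_inr, omegaMap,
      Matrix.reindex_apply, Matrix.submatrix_apply, Equiv.symm_apply_apply,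
      Matrix.fromBlocks_apply₁₁, Matrix.fromBlocks_apply₁₂, Matrix.fromBlocks_apply₂₁,
      Matrix.fromBlocks_apply₂₂, Matrix.map_apply, Matrix.neg_apply, map_add, map_sum, map_mul,
      Complex.conj_conj, neg_mul, mul_neg, Finset.sum_neg_distrib]
    ring

lemma star_omegaConj_dotProduct {n : ℕ} (x y : Fin (2 * n) → ℂ) :
    star (omegaConj n x) ⬝ᵥ omegaConj n y = starRingEnd ℂ (star x ⬝ᵥ y) := by
  simp only [dotProduct, finTwoMul_sum, Pi.star_apply, omegaConj_inl, omegaConj_inr]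
  simp
  ring

/-- The quaternionic space attached to a selfadjoint pair of matrices in `Ω_{2n}`. -/
def omegaSpace {n : ℕ} (H A : Matrix (Fin (2 * n)) (Fin (2 * n)) ℂ)
    (hHΩ : InOmega H) (hHu : IsUnit H) (hHherm : H.IsHermitian)
    (hAΩ : InOmega A) (hAsa : H * A = Aᴴ * H) : QuatSpace (Fin (2 * n) → ℂ) where
  A := Matrix.toLin' A
  σ := omegaConj n
  h x :=
    { toFun := fun y => star x ⬝ᵥ H *ᵥ y
      map_add' := fun y z => by rw [Matrix.mulVec_add, dotProduct_add]
      map_smul' := fun c y => by rw [Matrix.mulVec_smul, dotProduct_smul]; rfl }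
  σ_σ := omegaConj_omegaConj
  A_σ x := by simpa using hAΩ.mulVec_omegaConj x
  h_symm x y := by
    change star (star x ⬝ᵥ H *ᵥ y) = star y ⬝ᵥ H *ᵥ x
    rw [star_dotProduct, star_star, Matrix.star_mulVec, hHherm.eq, ← Matrix.dotProduct_mulVec]
  h_σ x y := by
    change star (omegaConj n x) ⬝ᵥ H *ᵥ omegaConj n y = starRingEnd ℂ (star x ⬝ᵥ H *ᵥ y)
    rw [hHΩ.mulVec_omegaConj, star_omegaConj_dotProduct]
  h_A x y := by
    change star (A *ᵥ x) ⬝ᵥ H *ᵥ y = star x ⬝ᵥ H *ᵥ (A *ᵥ y)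
    rw [Matrix.mulVec_mulVec, hAsa, Matrix.star_mulVec, ← Matrix.dotProduct_mulVec,
      Matrix.mulVec_mulVec]
  nondeg x hx := by
    have h1 : H *ᵥ x = 0 := by
      funext i
      have := hx (Pi.single i 1)
      change star (Pi.single i 1) ⬝ᵥ H *ᵥ x = 0 at this
      rwa [← Pi.single_star, star_one, single_one_dotProduct] at this
    exact Matrix.mulVec_injective_of_isUnit hHu (by rw [h1, Matrix.mulVec_zero])

/-- A matrix whose second half of columns is the structure map applied to the first half belongs
to `Ω_{2n}`. -/
lemma inOmega_of_col {n : ℕ} (S : Matrix (Fin (2 * n)) (Fin (2 * n)) ℂ)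
    (hS : ∀ j p, S p (finTwoMul n (.inr j)) =
      omegaConj n (fun q => S q (finTwoMul n (.inl j))) p) : InOmega S := by
  refine ⟨.of fun i j => S (finTwoMul n (.inl i)) (finTwoMul n (.inl j)),
    .of fun i j => -S (finTwoMul n (.inr i)) (finTwoMul n (.inl j)), ?_⟩
  rw [← Matrix.ext_iff]
  simp only [finTwoMul_forall, hS, omegaConj_inl, omegaConj_inr]
  simp [omegaMap]

/-- Two copies of a dependent sum of finite types, as a dependent sum over a product. -/
def sigmaFinTwoEquiv {κ : Type} (s : κ → ℕ) :
    ((x : Fin 2 × κ) × Fin (s x.2)) ≃ ((x : κ) × Fin (s x)) ⊕ ((x : κ) × Fin (s x)) where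
  toFun p := if p.1.1 = 0 then .inl ⟨p.1.2, p.2⟩ else .inr ⟨p.1.2, p.2⟩
  invFun := Sum.elim (fun q => ⟨(0, q.1), q.2⟩) (fun q => ⟨(1, q.1), q.2⟩)
  left_inv := by
    rintro ⟨⟨c, x⟩, i⟩
    fin_cases c <;> simp
  right_inv := by
    rintro (q | q) <;> simp

/-- An orthogonal family of blocks of full size is realised by a similarity in `Ω_{2n}`. -/
theorem exists_similarity {n : ℕ} (H A : Matrix (Fin (2 * n)) (Fin (2 * n)) ℂ)
    (hHΩ : InOmega H) (hHu : IsUnit H) (hHherm : H.IsHermitian)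
    (hAΩ : InOmega A) (hAsa : H * A = Aᴴ * H) {κ : Type} [Fintype κ] [DecidableEq κ]
    (B : κ → Block (Fin (2 * n) → ℂ))
    (hB : ∀ x, (omegaSpace H A hHΩ hHu hHherm hAΩ hAsa).IsBlock (B x))
    (hO : ∀ x y, x ≠ y → (omegaSpace H A hHΩ hHu hHherm hAΩ hAsa).Orth (B x) (B y))
    (hs : ∑ x, (B x).size = n) :
    ∃ (e : ((x : Fin 2 × κ) × Fin (B x.2).size) ≃ Fin (2 * n))
      (S : Matrix (Fin (2 * n)) (Fin (2 * n)) ℂ),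
      IsUnit S ∧ InOmega S ∧
      S⁻¹ * A * S = Matrix.reindex e e (Matrix.blockDiagonal' fun x : Fin 2 × κ =>
        if x.1 = 0 then (B x.2).J else (B x.2).J.map (starRingEnd ℂ)) ∧
      Sᴴ * H * S = Matrix.reindex e e (Matrix.blockDiagonal' fun x : Fin 2 × κ =>
        if x.1 = 0 then (B x.2).G else (B x.2).G.map (starRingEnd ℂ)) := by
  set D := omegaSpace H A hHΩ hHu hHherm hAΩ hAsa with hD
  set J' : ∀ x : Fin 2 × κ, Matrix (Fin (B x.2).size) (Fin (B x.2).size) ℂ := fun x =>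
    if x.1 = 0 then (B x.2).J else (B x.2).J.map (starRingEnd ℂ) with hJ'
  set G' : ∀ x : Fin 2 × κ, Matrix (Fin (B x.2).size) (Fin (B x.2).size) ℂ := fun x =>
    if x.1 = 0 then (B x.2).G else (B x.2).G.map (starRingEnd ℂ) with hG'
  let f : ((x : κ) × Fin (B x).size) ≃ Fin n := Fintype.equivFinOfCardEq (by simp [hs])
  let e : ((x : Fin 2 × κ) × Fin (B x.2).size) ≃ Fin (2 * n) :=
    (sigmaFinTwoEquiv fun x => (B x).size).trans ((f.sumCongr f).trans (finTwoMul n))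
  let X : ((x : Fin 2 × κ) × Fin (B x.2).size) → Fin (2 * n) → ℂ := fun p =>
    if p.1.1 = 0 then (B p.1.2).v p.2 else D.σ ((B p.1.2).v p.2)
  have hAX : ∀ x i, D.A (X ⟨x, i⟩) = ∑ j, J' x j i • X ⟨x, j⟩ := by
    rintro ⟨c, x⟩ i
    fin_cases c
    · simpa [X, hJ'] using (hB x).A_v i
    · simpa [X, hJ', ← D.A_σ] using congrArg D.σ ((hB x).A_v i)
  have hGX : ∀ p q, D.h (X p) (X q) = Matrix.blockDiagonal' G' p q := by
    rintro ⟨⟨c, x⟩, i⟩ ⟨⟨c', y⟩, j⟩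
    by_cases hxy : (c, x) = (c', y)
    · obtain ⟨rfl, rfl⟩ := Prod.mk.inj hxy
      rw [Matrix.blockDiagonal'_apply_eq]
      fin_cases c
      · simpa [X, hG'] using (hB x).gram i j
      · simp [X, hG', D.h_σ, (hB x).gram i j]
    · rw [Matrix.blockDiagonal'_apply_ne _ _ _ hxy]
      by_cases h : x = y
      · subst h
        have h0 := (hB x).gram_σ i j
        have h1 := (hB x).gram_σ j i
        fin_cases c <;> fin_cases c'
        · exact absurd rfl hxy
        · simpa [X] using h0
        · simpa [X] using D.h_zero_comm h1
        · exact absurd rfl hxy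
      · have h0 := hO x y h
        have h1 := h0.symm
        fin_cases c <;> fin_cases c'
        · simpa [X] using h0.1 i j
        · simpa [X] using h0.2 i j
        · simpa [X] using D.h_zero_comm (h1.2 j i)
        · simp [X, D.h_σ, h0.1 i j]
  let T : Matrix (Fin (2 * n)) ((x : Fin 2 × κ) × Fin (B x.2).size) ℂ :=
    Matrix.of fun r p => X p r
  have hAT : A * T = T * Matrix.blockDiagonal' J' := by
    ext r ⟨x, i⟩
    have h1 : (A * T) r ⟨x, i⟩ = D.A (X ⟨x, i⟩) r := by
      rw [hD]
      rfl
    rw [h1, hAX, Finset.sum_apply, Matrix.mul_apply, Fintype.sum_sigma,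
      Finset.sum_eq_single x]
    · simp [T, mul_comm]
    · intro y _ hy
      exact Finset.sum_eq_zero fun j _ => by
        rw [Matrix.blockDiagonal'_apply_ne _ _ _ hy, mul_zero]
    · simp
  have hTT : Tᴴ * H * T = Matrix.blockDiagonal' G' := by
    ext p q
    rw [← hGX, Matrix.mul_assoc]
    rfl
  have hGG : Matrix.blockDiagonal' G' * Matrix.blockDiagonal' G' = 1 := by
    rw [← Matrix.blockDiagonal'_mul, ← Matrix.blockDiagonal'_one]
    congr 1
    funext ⟨c, x⟩
    have hsq := (hB x).G_sq
    fin_cases c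
    · simpa [hG'] using hsq
    · have := congrArg (fun M => M.map (starRingEnd ℂ)) hsq
      simpa [hG', Matrix.map_mul, Matrix.map_one] using this
  let S : Matrix (Fin (2 * n)) (Fin (2 * n)) ℂ := T.submatrix id e.symm
  have hSS : Sᴴ * H * S = Matrix.reindex e e (Matrix.blockDiagonal' G') := by
    rw [← hTT]
    rfl
  have hSu : IsUnit S := by
    refine IsUnit.of_mul_eq_one_right
      (Matrix.reindex e e (Matrix.blockDiagonal' G') * (Sᴴ * H)) ?_
    rw [Matrix.mul_assoc, hSS, Matrix.reindex_apply, Matrix.submatrix_mul_equiv, hGG,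
      Matrix.submatrix_one_equiv]
  refine ⟨e, S, hSu, inOmega_of_col S fun j p => ?_, ?_, hSS⟩
  · simp [S, T, e, X, sigmaFinTwoEquiv]
    rfl
  · have h1 : A * S = S * Matrix.reindex e e (Matrix.blockDiagonal' J') := by
      have h2 := congrArg (fun M => M.submatrix id e.symm) hAT
      change A * S = _ at h2
      rw [h2, Matrix.reindex_apply]
      exact (Matrix.submatrix_mul_equiv T (Matrix.blockDiagonal' J') id e.symm e.symm).symm
    rw [Matrix.mul_assoc, h1, ← Matrix.mul_assoc,
      Matrix.nonsing_inv_mul _ ((Matrix.isUnit_iff_isUnit_det S).mp hSu), Matrix.one_mul]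

/-- **Theorem 2.5 (canonical form in `Ω_{2n}`).** The canonical form of an `H̃`-selfadjoint
matrix in `Ω_{2n}`: the real-eigenvalue blocks and the paired nonreal-eigenvalue blocks each
occur twice (the indexing component `c : Fin 2` distinguishes the two copies, with the order
of `λ` and `conj λ` swapped in the second copy), with the signed sip matrices repeated. -/
theorem omega_canonical_form {n : ℕ} (H A : Matrix (Fin (2 * n)) (Fin (2 * n)) ℂ)
    (hHΩ : InOmega H) (hHu : IsUnit H) (hHherm : H.IsHermitian)
    (hAΩ : InOmega A) (hAsa : H * A = Aᴴ * H) :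
    ∃ (a g : ℕ) (k : Fin a → ℕ) (l : Fin g → ℕ) (lr : Fin a → ℝ) (lc : Fin g → ℂ)
      (η : Fin a → ℝ)
      (e : ((x : Fin 2 × (Fin a ⊕ Fin g)) ×
          Fin (Sum.elim k (fun j => 2 * l j) x.2)) ≃ Fin (2 * n))
      (S : Matrix (Fin (2 * n)) (Fin (2 * n)) ℂ),
      (∀ j, 0 < (lc j).im) ∧
      (∀ j, η j = 1 ∨ η j = -1) ∧
      IsUnit S ∧ InOmega S ∧
      S⁻¹ * A * S = Matrix.reindex e e (Matrix.blockDiagonal'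
        (fun x : Fin 2 × (Fin a ⊕ Fin g) =>
          match x with
          | (_, Sum.inl j) => jordanBlock ((lr j : ℂ)) (k j)
          | (c, Sum.inr j) =>
              if c = 0 then
                dsum2 (jordanBlock (lc j) (l j)) (jordanBlock (starRingEnd ℂ (lc j)) (l j))
              else
                dsum2 (jordanBlock (starRingEnd ℂ (lc j)) (l j)) (jordanBlock (lc j) (l j)))) ∧
      Sᴴ * H * S = Matrix.reindex e e (Matrix.blockDiagonal'
        (fun x : Fin 2 × (Fin a ⊕ Fin g) =>
          match x with
          | (_, Sum.inl j) => η j • sip ℂ (k j)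
          | (_, Sum.inr j) => sip ℂ (2 * l j))) := by
  classical
  set D := omegaSpace H A hHΩ hHu hHherm hAΩ hAsa with hD
  obtain ⟨ι, _, F, hF, hB, hO, hs⟩ := QuatSpace.exists_family (2 * n) _ D (by simp)
  let ε : Fin (Fintype.card {i // (F i).IsReal}) ⊕ Fin (Fintype.card {i // ¬(F i).IsReal}) ≃ ι :=
    ((Fintype.equivFin _).symm.sumCongr (Fintype.equivFin _).symm).trans
      (Equiv.sumCompl fun i => (F i).IsReal)
  have hr : ∀ j, (F (ε (.inl j))).IsReal := fun j => ((Fintype.equivFin _).symm j).2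
  have hc : ∀ j, (F (ε (.inr j))).IsCplx := fun j =>
    (hF _).resolve_left ((Fintype.equivFin {i // ¬(F i).IsReal}).symm j).2
  choose k lr η v hη hv using hr
  choose l lc w hlc hw using hc
  let B : Fin (Fintype.card {i // (F i).IsReal}) ⊕ Fin (Fintype.card {i // ¬(F i).IsReal}) →
      Block (Fin (2 * n) → ℂ) := fun x =>
    { size := Sum.elim k (fun j => 2 * l j) x
      J := match x with
        | .inl j => jordanBlock (lr j : ℂ) (k j)
        | .inr j => dsum2 (jordanBlock (lc j) (l j)) (jordanBlock (starRingEnd ℂ (lc j)) (l j))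
      G := match x with
        | .inl j => η j • sip ℂ (k j)
        | .inr j => sip ℂ (2 * l j)
      v := match x with
        | .inl j => v j
        | .inr j => w j }
  have hFB : ∀ x, F (ε x) = B x := by
    rintro (j | j)
    · exact hv j
    · exact hw j
  obtain ⟨e, S, hSu, hSΩ, hSA, hSH⟩ := exists_similarity H A hHΩ hHu hHherm hAΩ hAsa B
    (fun x => hFB x ▸ hB _)
    (fun x y hxy => by
      rw [← hFB, ← hFB]
      exact hO _ _ (ε.injective.ne hxy))
    (by
      rw [← Equiv.sum_comp ε] at hs
      simp only [hFB] at hs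
      omega)
  refine ⟨_, _, k, l, lr, lc, η, e, S, hlc, hη, hSu, hSΩ, hSA.trans ?_, hSH.trans ?_⟩
  · have hJ : ∀ (z : ℂ) (m : ℕ), (jordanBlock z m).map (starRingEnd ℂ) =
        jordanBlock (starRingEnd ℂ z) m := fun z m => Matrix.ext (jordanBlock_map_conj z m)
    congr 2
    funext ⟨c, x⟩
    rcases x with j | j <;> fin_cases c
    · rfl
    · exact (hJ _ _).trans (by rw [Complex.conj_ofReal]; rfl)
    · rfl
    · refine (Matrix.ext (dsum2_map_conj _ _)).trans ?_
      rw [hJ, hJ, Complex.conj_conj]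
      rfl
  · have hsip : ∀ m : ℕ, (sip ℂ m).map (starRingEnd ℂ) = sip ℂ m := fun m => by
      ext i i'
      simp only [sip, Matrix.map_apply, Matrix.of_apply]
      split_ifs <;> simp
    have hsmul : ∀ (c : ℝ) (m : ℕ), (c • sip ℂ m).map (starRingEnd ℂ) = c • sip ℂ m :=
      fun c m => by
        rw [Matrix.map_smul _ c fun x => by simp, hsip]
    congr 2
    funext ⟨c, x⟩
    rcases x with j | j <;> fin_cases c
    · rfl
    · exact hsmul _ _
    · rfl
    · exact hsip _

end
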